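/- Define G_m(s) := ∫₀^π sin(mθ) sin(θ) (s + 2(1 − cos θ))^{−3/2} dθ for integers m ≥ 0 and s > 0. Then: (i) there exists a uniform constant C > 0 such that for every integer m ≥ 3 and every s > 4, s^{7/2} |G_m(s)| ≤ C; and (ii) for every integer m ≥ 3 and every 0 < s ≤ 4, s |G_m(s)| ≤ 2π. -/

import Mathlib

open Real MeasureTheory

noncomputable section

/-- `G_m(s) = ∫₀^π sin(mθ) sin θ (s + 2(1 − cos θ))^{−3/2} dθ`. -/
def Gm (m : ℕ) (s : ℝ) : ℝ :=
  ∫ θ in (0:ℝ)..Real.pi,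
    Real.sin (m * θ) * Real.sin θ * (s + 2 * (1 - Real.cos θ)) ^ (-(3:ℝ)/2)

lemma rpow_half_eq_sqrt_pow {x : ℝ} (hx : 0 ≤ x) (n : ℕ) :
    x ^ ((n : ℝ) / 2) = √x ^ n := by
  rw [Real.sqrt_eq_rpow, ← Real.rpow_natCast, ← Real.rpow_mul hx]
  congr 1
  ring

lemma rpow_neg_three_halves {x : ℝ} (hx : 0 ≤ x) :
    x ^ (-(3:ℝ)/2) = (√x ^ 3)⁻¹ := by
  rw [neg_div, Real.rpow_neg hx, ← rpow_half_eq_sqrt_pow hx 3]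
  norm_num

lemma integral_cos_int_mul {k : ℤ} (hk : k ≠ 0) :
    ∫ θ in (0:ℝ)..Real.pi, Real.cos (k * θ) = 0 := by
  have hk' : (k : ℝ) ≠ 0 := by exact_mod_cast hk
  rw [intervalIntegral.integral_comp_mul_left (fun x => Real.cos x) hk', integral_cos]
  simp [Real.sin_int_mul_pi]

/-- `sin(mθ) sin θ` is orthogonal to `1` and `cos θ` on `[0, π]` for `m ≥ 3`. -/
lemma integral_sin_mul_sin_mul_affine_cos {m : ℕ} (hm : 3 ≤ m) (a b : ℝ) :
    ∫ θ in (0:ℝ)..Real.pi, Real.sin (m * θ) * Real.sin θ * (a + b * Real.cos θ) = 0 := by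
  have key : ∀ θ : ℝ, Real.sin (m * θ) * Real.sin θ * (a + b * Real.cos θ) =
      a / 2 * Real.cos (((m - 1 : ℤ) : ℝ) * θ) - a / 2 * Real.cos (((m + 1 : ℤ) : ℝ) * θ)
      + (b / 4 * Real.cos (((m - 2 : ℤ) : ℝ) * θ)
        - b / 4 * Real.cos (((m + 2 : ℤ) : ℝ) * θ)) := by
    intro θ
    push_cast
    simp only [sub_mul, add_mul, one_mul, Real.cos_sub, Real.cos_add, Real.sin_two_mul]
    ring
  have hi : ∀ (c : ℝ) (k : ℤ), IntervalIntegrable (fun θ : ℝ => c * Real.cos (k * θ))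
      volume 0 Real.pi := fun c k => Continuous.intervalIntegrable (by fun_prop) _ _
  simp_rw [key]
  rw [intervalIntegral.integral_add ((hi _ _).sub (hi _ _)) ((hi _ _).sub (hi _ _)),
    intervalIntegral.integral_sub (hi _ _) (hi _ _),
    intervalIntegral.integral_sub (hi _ _) (hi _ _)]
  simp only [intervalIntegral.integral_const_mul]
  rw [integral_cos_int_mul (by omega), integral_cos_int_mul (by omega),
    integral_cos_int_mul (by omega), integral_cos_int_mul (by omega)]
  ring

/-- First-order Taylor estimate for `x ↦ x ^ (-3/2)`, written in terms of square roots. -/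
lemma abs_inv_cube_sub_affine_le {r t : ℝ} (hr : 0 < r) (hrt : r ≤ t) :
    |(t ^ 3)⁻¹ - ((r ^ 3)⁻¹ - 3 / 2 * (r ^ 5)⁻¹ * (t ^ 2 - r ^ 2))|
      ≤ 15 / 8 * (t ^ 2 - r ^ 2) ^ 2 / r ^ 7 := by
  have ht : 0 < t := hr.trans_le hrt
  have h : (t ^ 3)⁻¹ - ((r ^ 3)⁻¹ - 3 / 2 * (r ^ 5)⁻¹ * (t ^ 2 - r ^ 2)) =
      (t - r) ^ 2 * (3 * t ^ 3 + 6 * t ^ 2 * r + 4 * t * r ^ 2 + 2 * r ^ 3)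
        / (2 * r ^ 5 * t ^ 3) := by
    field_simp
    ring
  rw [h, abs_of_nonneg (by positivity)]
  have h1 : 3 * t ^ 3 + 6 * t ^ 2 * r + 4 * t * r ^ 2 + 2 * r ^ 3 ≤ 15 * t ^ 3 := by
    have a1 : t ^ 2 * r ≤ t ^ 2 * t := by gcongr
    have a2 : t * r ^ 2 ≤ t * t ^ 2 := by gcongr
    have a3 : r ^ 3 ≤ t ^ 3 := by gcongr
    linarith
  have h2 : 2 * r ≤ t + r := by linarith
  calc _ ≤ (t - r) ^ 2 * (15 * t ^ 3) / (2 * r ^ 5 * t ^ 3) := by gcongr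
    _ = 15 / 8 * ((t - r) ^ 2 * (2 * r) ^ 2) / r ^ 7 := by field_simp; ring
    _ ≤ 15 / 8 * ((t - r) ^ 2 * (t + r) ^ 2) / r ^ 7 := by gcongr
    _ = _ := by ring

lemma continuous_Gm_integrand (m : ℕ) {s : ℝ} (hs : 0 < s) :
    Continuous fun θ : ℝ =>
      Real.sin (m * θ) * Real.sin θ * (s + 2 * (1 - Real.cos θ)) ^ (-(3:ℝ)/2) := by
  refine Continuous.mul (by fun_prop) (Continuous.rpow_const (by fun_prop) fun θ => Or.inl ?_)
  linarith [Real.cos_le_one θ]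

lemma abs_Gm_le_div_sqrt_pow {m : ℕ} (hm : 3 ≤ m) {s : ℝ} (hs : 0 < s) :
    |Gm m s| ≤ 30 / √s ^ 7 * Real.pi := by
  set r := √s with hr
  have hr0 : 0 < r := Real.sqrt_pos.2 hs
  have hr2 : r ^ 2 = s := Real.sq_sqrt hs.le
  set a := (r ^ 3)⁻¹ - 3 * (r ^ 5)⁻¹ with ha
  set b := 3 * (r ^ 5)⁻¹ with hb
  have hG : Gm m s = ∫ θ in (0:ℝ)..Real.pi,
      (Real.sin (m * θ) * Real.sin θ * (s + 2 * (1 - Real.cos θ)) ^ (-(3:ℝ)/2)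
        - Real.sin (m * θ) * Real.sin θ * (a + b * Real.cos θ)) := by
    rw [intervalIntegral.integral_sub ((continuous_Gm_integrand m hs).intervalIntegrable _ _)
      (Continuous.intervalIntegrable (by fun_prop) _ _),
      integral_sin_mul_sin_mul_affine_cos hm, sub_zero, Gm]
  rw [hG, ← Real.norm_eq_abs]
  refine (intervalIntegral.norm_integral_le_of_norm_le_const (C := 30 / r ^ 7)
    fun θ _ => ?_).trans_eq (by rw [sub_zero, abs_of_pos Real.pi_pos])
  have hu0 : 0 ≤ 2 * (1 - Real.cos θ) := by linarith [Real.cos_le_one θ]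
  have hu4 : 2 * (1 - Real.cos θ) ≤ 4 := by linarith [Real.neg_one_le_cos θ]
  have hsu : 0 ≤ s + 2 * (1 - Real.cos θ) := by linarith
  rw [rpow_neg_three_halves hsu, ← mul_sub, Real.norm_eq_abs, abs_mul, abs_mul]
  set t := √(s + 2 * (1 - Real.cos θ)) with ht
  have ht2 : t ^ 2 - r ^ 2 = 2 * (1 - Real.cos θ) := by
    rw [hr2, ht, Real.sq_sqrt hsu]; ring
  have hrt : r ≤ t := Real.sqrt_le_sqrt (by linarith)
  have hT := abs_inv_cube_sub_affine_le hr0 hrt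
  rw [ht2] at hT
  have hab : a + b * Real.cos θ =
      (r ^ 3)⁻¹ - 3 / 2 * (r ^ 5)⁻¹ * (2 * (1 - Real.cos θ)) := by
    rw [ha, hb]; ring
  rw [hab]
  calc _ ≤ 1 * 1 * (15 / 8 * (2 * (1 - Real.cos θ)) ^ 2 / r ^ 7) := by
        gcongr
        exacts [Real.abs_sin_le_one _, Real.abs_sin_le_one _]
    _ ≤ 1 * 1 * (15 / 8 * 4 ^ 2 / r ^ 7) := by gcongr
    _ = 30 / r ^ 7 := by ring

lemma abs_Gm_le_inv (m : ℕ) {s : ℝ} (hs : 0 < s) : |Gm m s| ≤ s⁻¹ * Real.pi := by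
  rw [Gm, ← Real.norm_eq_abs]
  refine (intervalIntegral.norm_integral_le_of_norm_le_const (C := s⁻¹)
    fun θ _ => ?_).trans_eq (by rw [sub_zero, abs_of_pos Real.pi_pos])
  have hu0 : 0 ≤ 2 * (1 - Real.cos θ) := by linarith [Real.cos_le_one θ]
  have hsu : 0 < s + 2 * (1 - Real.cos θ) := by linarith
  rw [rpow_neg_three_halves hsu.le, Real.norm_eq_abs, abs_mul, abs_mul]
  have hsin : |Real.sin θ| ≤ √(s + 2 * (1 - Real.cos θ)) := by
    apply Real.abs_le_sqrt
    nlinarith [Real.sin_sq_add_cos_sq θ, sq_nonneg (1 - Real.cos θ)]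
  have ht2 := Real.sq_sqrt hsu.le
  set t := √(s + 2 * (1 - Real.cos θ)) with ht
  have ht0 : 0 < t := Real.sqrt_pos.2 hsu
  rw [abs_of_pos (by positivity : 0 < (t ^ 3)⁻¹)]
  calc _ ≤ 1 * t * (t ^ 3)⁻¹ := by
        gcongr
        exact Real.abs_sin_le_one _
    _ = (t ^ 2)⁻¹ := by field_simp
    _ ≤ s⁻¹ := by gcongr; linarith

/-- Estimates (A.12) and (A.13): bounds on `G_m` for large and small `s`. -/
theorem Gm_bounds :
    (∃ C : ℝ, 0 < C ∧ ∀ (m : ℕ), 3 ≤ m → ∀ s : ℝ, 4 < s →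
      s ^ ((7:ℝ)/2) * |Gm m s| ≤ C) ∧
    (∀ (m : ℕ), 3 ≤ m → ∀ s : ℝ, 0 < s → s ≤ 4 → s * |Gm m s| ≤ 2 * Real.pi) := by
  refine ⟨⟨30 * Real.pi, by positivity, fun m hm s hs => ?_⟩, fun m _ s hs _ => ?_⟩
  · have hs0 : 0 < s := by linarith
    have hr : 0 < √s := Real.sqrt_pos.2 hs0
    have hpow : s ^ ((7:ℝ)/2) = √s ^ 7 := by
      exact_mod_cast rpow_half_eq_sqrt_pow hs0.le 7
    rw [hpow]
    calc _ ≤ √s ^ 7 * (30 / √s ^ 7 * Real.pi) := by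
          gcongr
          exact abs_Gm_le_div_sqrt_pow hm hs0
      _ = 30 * Real.pi := by field_simp
  · calc s * |Gm m s| ≤ s * (s⁻¹ * Real.pi) := by
          gcongr
          exact abs_Gm_le_inv m hs
      _ = Real.pi := by field_simp
      _ ≤ 2 * Real.pi := by linarith [Real.pi_pos]

end
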